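/- Let μ be a probability measure on G = (ℤ/2ℤ)³ with a_max = μ({0}) and a_max > 1/4. Suppose condition II.1 holds: for every subgroup K ∈ 𝔄₂, (a) μ ∈ U(K) or μ ∈ U(K̄), and (b) μ ∈ V(K) or μ ∈ V(K̄). Then μ ∈ TEC(G). -/

import Mathlib

open scoped BigOperators

/-- The group `G = (ℤ/2ℤ)³`. -/
abbrev G : Type := ZMod 2 × ZMod 2 × ZMod 2

/-- The character pairing `(x,y) = (-1)^(x₁y₁+x₂y₂+x₃y₃)`. -/
noncomputable def pairing (x y : G) : ℝ :=
  (-1 : ℝ) ^ (x.1.val * y.1.val + x.2.1.val * y.2.1.val + x.2.2.val * y.2.2.val)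

/-- A probability measure on `G`, given by its mass function. -/
def IsProb (p : G → ℝ) : Prop := (∀ x, 0 ≤ p x) ∧ ∑ x : G, p x = 1

/-- The characteristic function `μ̂(y) = Σ_x (x,y) μ({x})`. -/
noncomputable def charFn (p : G → ℝ) (y : G) : ℝ := ∑ x : G, pairing x y * p x

/-- The measure of a set `E ⊆ G`. -/
noncomputable def measOf (p : G → ℝ) (E : Set G) : ℝ := ∑ x : G, E.indicator p x

/-- `μ` has a trivial equivalence class: every probability measure `ν` with
`|ν̂| = |μ̂|` is a shift `μₓ` of `μ` (central symmetry is the identity on `G`). -/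
def TEC (p : G → ℝ) : Prop :=
  ∀ q : G → ℝ, IsProb q → (∀ y : G, |charFn q y| = |charFn p y|) →
    ∃ x : G, ∀ e : G, q e = p (e + x)

/-- `u(E) = max_{x ∈ E} μ({x})`. -/
noncomputable def uOf (p : G → ℝ) (E : Set G) : ℝ := sSup (p '' E)

/-- `v(E) = min_{x ∈ E} μ({x})`. -/
noncomputable def vOf (p : G → ℝ) (E : Set G) : ℝ := sInf (p '' E)

/-- `μ ∈ U(E)` iff `2 u(E) > μ(E)`. -/
def USet (p : G → ℝ) (E : Set G) : Prop := measOf p E < 2 * uOf p E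

/-- `μ ∈ V(E)` iff `1/2 + 2 v(E) < μ(E)`. -/
def VSet (p : G → ℝ) (E : Set G) : Prop := 1/2 + 2 * vOf p E < measOf p E

lemma group_add_self : ∀ x : G, x + x = 0 := by decide

/-- The bilinear form `x₁y₁+x₂y₂+x₃y₃` on `G` with values in `ℤ/2ℤ`. -/
def dot (x y : G) : ZMod 2 := x.1 * y.1 + x.2.1 * y.2.1 + x.2.2 * y.2.2

lemma dot_add_left (x x' y : G) : dot (x + x') y = dot x y + dot x' y := by
  simp only [dot, Prod.fst_add, Prod.snd_add]
  ring

/-- The nontrivial sign character of `ℤ/2ℤ`. -/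
noncomputable def sgn (t : ZMod 2) : ℝ := if t = 0 then 1 else -1

lemma sgn_zero : sgn 0 = 1 := by simp [sgn]

lemma sgn_one : sgn 1 = -1 := by simp [sgn]

lemma zmod_two_cases : ∀ t : ZMod 2, t = 0 ∨ t = 1 := by decide

lemma sgn_add (s t : ZMod 2) : sgn (s + t) = sgn s * sgn t := by
  rcases zmod_two_cases s with rfl | rfl <;> rcases zmod_two_cases t with rfl | rfl <;>
    simp [sgn_zero, sgn_one, show (1 + 1 : ZMod 2) = 0 from rfl]

lemma neg_one_pow_val_mul (s t : ZMod 2) : (-1 : ℝ) ^ (s.val * t.val) = sgn (s * t) := by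
  rcases zmod_two_cases s with rfl | rfl <;> rcases zmod_two_cases t with rfl | rfl <;>
    simp [sgn_zero, sgn_one, ZMod.val_one]

lemma pairing_eq_sgn (x y : G) : pairing x y = sgn (dot x y) := by
  simp only [pairing, dot, pow_add, sgn_add, neg_one_pow_val_mul]

lemma pairing_add_left (x x' y : G) : pairing (x + x') y = pairing x y * pairing x' y := by
  simp only [pairing_eq_sgn, dot_add_left, sgn_add]

lemma pairing_zero_right (x : G) : pairing x 0 = 1 := by simp [pairing]

/-- A sum over `G`, written out in coordinates. -/
lemma sum_eq_coords (g : G → ℝ) :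
    ∑ x : G, g x = g (0, 0, 0) + g (0, 0, 1) + g (0, 1, 0) + g (0, 1, 1) +
      g (1, 0, 0) + g (1, 0, 1) + g (1, 1, 0) + g (1, 1, 1) := by
  have h (k : ZMod 2 → ℝ) : ∑ t, k t = k 0 + k 1 := Fin.sum_univ_two k
  simp only [Fintype.sum_prod_type, h]
  ring

lemma sum_pairing_mul_pairing (x x' : G) :
    ∑ y : G, pairing x y * pairing x' y = if x' = x then 8 else 0 := by
  simp only [← pairing_add_left]
  split_ifs with h
  · have h0 : x + x' = 0 := by rw [h, group_add_self]
    simp only [h0, pairing, Prod.fst_zero, Prod.snd_zero, ZMod.val_zero, zero_mul, add_zero,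
      pow_zero, Finset.sum_const, Finset.card_univ]
    norm_num [show Fintype.card G = 8 from rfl]
  · have h0 : x + x' ≠ 0 := by revert x x'; decide
    generalize x + x' = w at h0
    obtain ⟨a, b, c⟩ := w
    simp only [sum_eq_coords, pairing_eq_sgn, dot, sgn_add, mul_zero, mul_one, sgn_zero]
    rcases zmod_two_cases a with rfl | rfl <;> rcases zmod_two_cases b with rfl | rfl <;>
      rcases zmod_two_cases c with rfl | rfl <;> simp [sgn_zero, sgn_one] at h0 ⊢

/-- Fourier inversion on `G`. -/
lemma sum_pairing_mul_charFn (p : G → ℝ) (x : G) :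
    ∑ y : G, pairing x y * charFn p y = 8 * p x := by
  simp only [charFn, Finset.mul_sum]
  rw [Finset.sum_comm]
  simp only [← mul_assoc, ← Finset.sum_mul, sum_pairing_mul_pairing]
  simp [ite_mul]

lemma charFn_zero {p : G → ℝ} (hp : IsProb p) : charFn p 0 = 1 := by
  simp [charFn, pairing_zero_right, hp.2]

/-- Every sign pattern normalised at `0` is, up to a character, trivial, changed at one point,
or changed at all points except `0` and possibly one more. -/
lemma sign_pattern (f : G → ZMod 2) (h0 : f 0 = 0) :
    ∃ a : G, (∀ y, f y = dot a y) ∨ (∀ y, f y = dot a y + (1 + if y = 0 then 1 else 0)) ∨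
      ∃ z, z ≠ 0 ∧ ((∀ y, f y = dot a y + if y = z then 1 else 0) ∨
        ∀ y, f y = dot a y + (1 + ((if y = 0 then 1 else 0) + if y = z then 1 else 0))) := by
  revert f
  decide +kernel

/-- The annihilator of a point of `G`. -/
def annihilator (z : G) : AddSubgroup G where
  carrier := {x | dot x z = 0}
  zero_mem' := by simp [dot]
  add_mem' {x y} hx hy := by
    rw [Set.mem_ofPred_eq] at hx hy ⊢
    rw [dot_add_left, hx, hy, add_zero]
  neg_mem' {x} hx := by
    rw [Set.mem_ofPred_eq] at hx ⊢
    rwa [neg_eq_of_add_eq_zero_left (group_add_self x)]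

lemma mem_annihilator {x z : G} : x ∈ (annihilator z : Set G) ↔ dot x z = 0 := Iff.rfl

lemma card_annihilator {z : G} (hz : z ≠ 0) : Nat.card (annihilator z) = 4 := by
  have h : ∀ z : G, z ≠ 0 → Fintype.card {x : G // dot x z = 0} = 4 := by decide +kernel
  rw [← h z hz, ← Nat.card_eq_fintype_card]
  rfl

lemma USet.exists_mem {p : G → ℝ} {E : Set G} (h : USet p E) :
    ∃ x ∈ E, measOf p E < 2 * p x := by
  rcases E.eq_empty_or_nonempty with rfl | hE
  · simp [USet, measOf, uOf] at h
  · obtain ⟨x, hx, hxe⟩ := (hE.image p).csSup_mem (Set.toFinite _)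
    exact ⟨x, hx, hxe ▸ h⟩

lemma VSet.exists_mem {p : G → ℝ} {E : Set G} (h : VSet p E) :
    ∃ x ∈ E, 1/2 + 2 * p x < measOf p E := by
  rcases E.eq_empty_or_nonempty with rfl | hE
  · norm_num [VSet, measOf, vOf] at h
  · obtain ⟨x, hx, hxe⟩ := (hE.image p).csInf_mem (Set.toFinite _)
    exact ⟨x, hx, hxe ▸ h⟩

lemma two_mul_measOf_annihilator {p : G → ℝ} (hp : IsProb p) (z : G) :
    2 * measOf p (annihilator z) = 1 + charFn p z := by
  rw [← hp.2, measOf, charFn, ← Finset.sum_add_distrib, Finset.mul_sum]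
  refine Finset.sum_congr rfl fun x _ => ?_
  by_cases h : dot x z = 0 <;>
    simp [Set.indicator, mem_annihilator, pairing_eq_sgn, sgn, h, two_mul, -SetLike.mem_coe]

lemma two_mul_measOf_compl_annihilator {p : G → ℝ} (hp : IsProb p) (z : G) :
    2 * measOf p (annihilator z : Set G)ᶜ = 1 - charFn p z := by
  rw [← hp.2, measOf, charFn, ← Finset.sum_sub_distrib, Finset.mul_sum]
  refine Finset.sum_congr rfl fun x _ => ?_
  by_cases h : dot x z = 0 <;>
    simp [Set.indicator, mem_annihilator, pairing_eq_sgn, sgn, h, two_mul, -SetLike.mem_coe]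

lemma exists_of_USet {p : G → ℝ} (hp : IsProb p) {z : G}
    (h : USet p (annihilator z) ∨ USet p (annihilator z : Set G)ᶜ) :
    ∃ x, 1 + pairing x z * charFn p z < 4 * p x := by
  rcases h with h | h <;> obtain ⟨x, hx, hlt⟩ := h.exists_mem <;> refine ⟨x, ?_⟩
  · rw [mem_annihilator] at hx
    rw [pairing_eq_sgn, hx, sgn_zero]
    linarith [two_mul_measOf_annihilator hp z]
  · rw [Set.mem_compl_iff, mem_annihilator] at hx
    rw [pairing_eq_sgn, sgn, if_neg hx]
    linarith [two_mul_measOf_compl_annihilator hp z]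

lemma exists_of_VSet {p : G → ℝ} (hp : IsProb p) {z : G}
    (h : VSet p (annihilator z) ∨ VSet p (annihilator z : Set G)ᶜ) :
    ∃ x, 4 * p x < pairing x z * charFn p z := by
  rcases h with h | h <;> obtain ⟨x, hx, hlt⟩ := h.exists_mem <;> refine ⟨x, ?_⟩
  · rw [mem_annihilator] at hx
    rw [pairing_eq_sgn, hx, sgn_zero]
    linarith [two_mul_measOf_annihilator hp z]
  · rw [Set.mem_compl_iff, mem_annihilator] at hx
    rw [pairing_eq_sgn, sgn, if_neg hx]
    linarith [two_mul_measOf_compl_annihilator hp z]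

/-- If the characteristic functions differ by a shift and a sign pattern, the second measure is
obtained from the first by a shift and a convolution. -/
lemma eight_mul_apply_add {p q : G → ℝ} {f e : G → ZMod 2} {a : G}
    (hf : ∀ y, charFn q y = sgn (f y) * charFn p y) (he : ∀ y, f y = dot a y + e y) (x : G) :
    8 * q (x + a) = ∑ y : G, sgn (e y) * (pairing x y * charFn p y) := by
  rw [← sum_pairing_mul_charFn]
  refine Finset.sum_congr rfl fun y _ => ?_
  have h : sgn (dot a y) * sgn (dot a y) = 1 := by
    rcases zmod_two_cases (dot a y) with h | h <;> simp [h, sgn_zero, sgn_one]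
  rw [hf, he, sgn_add, pairing_add_left, pairing_eq_sgn a y]
  linear_combination (pairing x y * sgn (e y) * charFn p y) * h

lemma sgn_ite (P : Prop) [Decidable P] :
    sgn (if P then 1 else 0) = 1 - if P then 2 else 0 := by
  split_ifs <;> norm_num [sgn_zero, sgn_one]

/-- `a_max = μ({0}) > 1/4` and condition II.1 imply `μ ∈ TEC(G)`. -/
theorem stmt3 (p : G → ℝ) (hp : IsProb p)
    (hmax : ∀ x : G, p x ≤ p 0) (hgt : 1/4 < p 0)
    (hII1 : ∀ K : AddSubgroup G, Nat.card K = 4 →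
      (USet p (K : Set G) ∨ USet p ((K : Set G))ᶜ) ∧
      (VSet p (K : Set G) ∨ VSet p ((K : Set G))ᶜ)) :
    TEC p := by
  intro q hq hpq
  have hsign (y : G) : ∃ t : ZMod 2, charFn q y = sgn t * charFn p y := by
    rcases abs_eq_abs.mp (hpq y) with h | h
    · exact ⟨0, by simp [sgn_zero, h]⟩
    · exact ⟨1, by simp [sgn_one, h]⟩
  choose f hf using hsign
  have hf0 : f 0 = 0 := by
    have h := hf 0
    rw [charFn_zero hp, charFn_zero hq] at h
    rcases zmod_two_cases (f 0) with h0 | h0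
    · exact h0
    · norm_num [h0, sgn_one] at h
  obtain ⟨a, h | h | ⟨z, hz, h | h⟩⟩ := sign_pattern f hf0
  · refine ⟨a, fun x => ?_⟩
    have h8 := eight_mul_apply_add (e := 0) hf (by simpa using h) (x + a)
    simp only [Pi.zero_apply, sgn_zero, one_mul, sum_pairing_mul_charFn] at h8
    rw [add_assoc, group_add_self a, add_zero] at h8
    linarith
  · have h8 := eight_mul_apply_add hf h 0
    simp only [sgn_add, sgn_one, sgn_ite, mul_sub, sub_mul, Finset.sum_sub_distrib, mul_assoc,
      ← Finset.mul_sum, sum_pairing_mul_charFn, ite_mul, zero_mul, one_mul, Finset.sum_ite_eq',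
      Finset.mem_univ, if_true, pairing_zero_right, charFn_zero hp] at h8
    linarith [hq.1 (0 + a)]
  · obtain ⟨x, hx⟩ := exists_of_VSet hp (hII1 _ (card_annihilator hz)).2
    have h8 := eight_mul_apply_add hf h x
    simp only [sgn_ite, sub_mul, Finset.sum_sub_distrib, sum_pairing_mul_charFn, ite_mul, zero_mul,
      one_mul, Finset.sum_ite_eq', Finset.mem_univ, if_true] at h8
    linarith [hq.1 (x + a)]
  · obtain ⟨x, hx⟩ := exists_of_USet hp (hII1 _ (card_annihilator hz)).1
    have h8 := eight_mul_apply_add hf h x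
    have hs (y : G) : sgn (1 + ((if y = 0 then 1 else 0) + if y = z then 1 else 0)) =
        (if y = 0 then 2 else 0) + (if y = z then 2 else 0) - 1 := by
      simp only [sgn_add, sgn_one, sgn_ite]
      by_cases h0 : y = 0
      · norm_num [h0, hz.symm]
      · simp [h0]
    simp only [hs, sub_mul, add_mul, Finset.sum_sub_distrib, Finset.sum_add_distrib,
      sum_pairing_mul_charFn, ite_mul, zero_mul, one_mul, Finset.sum_ite_eq', Finset.mem_univ,
      if_true, pairing_zero_right, charFn_zero hp] at h8
    linarith [hq.1 (x + a)]
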